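/- Let 𝔤 be a Lie algebra over a finite field F, and suppose 𝔤 is covered by |F| + 1 proper Lie subalgebras 𝔥₁, 𝔥₂, …, 𝔥_{|F|+1} (i.e., every element of 𝔤 lies in at least one 𝔥ᵢ). Then each 𝔥ᵢ has codimension 1 in 𝔤, i.e., dim(𝔤/𝔥ᵢ) = 1 as vector spaces for every i. -/

import Mathlib

/-- If `x ∉ V`, then the line `{y + t • x}` meets the submodule `V` in at most one point. -/
theorem Submodule.eq_of_add_smul_mem {F M : Type*} [Field F] [AddCommGroup M] [Module F M]
    {V : Submodule F M} {x y : M} (hx : x ∉ V) {t u : F} (ht : y + t • x ∈ V)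
    (hu : y + u • x ∈ V) : t = u := by
  by_contra hne
  have h : (t - u) • x ∈ V := by
    have h := V.sub_mem ht hu
    rwa [add_sub_add_left_eq_sub, ← sub_smul] at h
  exact hx ((V.smul_mem_iff (sub_ne_zero.mpr hne)).mp h)

/-- If `x ∈ V` and `y ∉ V`, then the line `{y + t • x}` does not meet the submodule `V`. -/
theorem Submodule.add_smul_notMem {F M : Type*} [Field F] [AddCommGroup M] [Module F M]
    {V : Submodule F M} {x y : M} (hx : x ∈ V) (hy : y ∉ V) (t : F) : y + t • x ∉ V :=
  fun h => hy ((V.add_mem_iff_left (V.smul_mem t hx)).mp h)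

/-- A vector space over a finite field `F` is not covered by `|F|` proper subspaces. -/
theorem Submodule.exists_forall_notMem_of_card_le {F M ι : Type*} [Field F] [Fintype F]
    [AddCommGroup M] [Module F M] (V : ι → Submodule F M) (hV : ∀ i, V i ≠ ⊤) (s : Finset ι)
    (hs : s.card ≤ Fintype.card F) : ∃ x, ∀ i ∈ s, x ∉ V i := by
  classical
  induction s using Finset.induction_on with
  | empty => exact ⟨0, by simp⟩
  | insert a s ha ih =>
    rw [Finset.card_insert_of_notMem ha] at hs
    obtain ⟨x, hx⟩ := ih (by omega)
    by_cases hxa : x ∈ V a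
    · obtain ⟨y, hy⟩ : ∃ y, y ∉ V a := by
        by_contra! h
        exact hV a (Submodule.eq_top_iff'.mpr h)
      by_contra! hcov
      have hline : ∀ t : F, ∃ i ∈ s, y + t • x ∈ V i := by
        intro t
        obtain ⟨i, hi, hmem⟩ := hcov (y + t • x)
        rcases Finset.mem_insert.mp hi with rfl | hi
        · exact absurd hmem (Submodule.add_smul_notMem hxa hy t)
        · exact ⟨i, hi, hmem⟩
      choose f hfs hf using hline
      have hcard : (Finset.univ : Finset F).card ≤ s.card := by
        refine Finset.card_le_card_of_injOn f (fun t _ => hfs t) fun t _ u _ htu => ?_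
        exact Submodule.eq_of_add_smul_mem (hx _ (hfs t)) (hf t) (htu ▸ hf u)
      rw [Finset.card_univ] at hcard
      omega
    · refine ⟨x, fun i hi => ?_⟩
      rcases Finset.mem_insert.mp hi with rfl | hi
      exacts [hxa, hx i hi]

/-- If a vector space over a finite field `F` is covered by `|F| + 1` proper subspaces, then each
of them has codimension `1`. -/
theorem Submodule.finrank_quotient_eq_one_of_cover {F M ι : Type*} [Field F] [Fintype F]
    [AddCommGroup M] [Module F M] [Fintype ι] (hι : Fintype.card ι = Fintype.card F + 1)
    (V : ι → Submodule F M) (hV : ∀ i, V i ≠ ⊤) (hcover : ∀ x, ∃ i, x ∈ V i) (j : ι) :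
    Module.finrank F (M ⧸ V j) = 1 := by
  classical
  have : Nontrivial ι :=
    Fintype.one_lt_card_iff_nontrivial.mp (by have := Fintype.card_pos (α := F); omega)
  obtain ⟨i, hij⟩ := exists_ne j
  have hcard : (Finset.univ.erase i).card = Fintype.card F := by
    rw [Finset.card_erase_of_mem (Finset.mem_univ i), Finset.card_univ, hι, Nat.add_sub_cancel]
  obtain ⟨x, hx⟩ := Submodule.exists_forall_notMem_of_card_le V hV _ hcard.le
  have hx' : ∀ k, k ≠ i → x ∉ V k := fun k hk => hx k (by simp [hk])
  have hxi : x ∈ V i := by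
    obtain ⟨k, hk⟩ := hcover x
    by_cases hki : k = i
    · exact hki ▸ hk
    · exact absurd hk (hx' k hki)
  have hline : ∀ y, y ∉ V i → ∃ t : F, y + t • x ∈ V j := by
    intro y hy
    choose f hf using fun t : F => hcover (y + t • x)
    have hfi : ∀ t, f t ≠ i := fun t h =>
      Submodule.add_smul_notMem hxi hy t (h ▸ hf t)
    have hinj : Set.InjOn f (Finset.univ : Finset F) := fun t _ u _ htu =>
      Submodule.eq_of_add_smul_mem (hx' _ (hfi t)) (hf t) (htu ▸ hf u)
    obtain ⟨t, -, ht⟩ := Finset.surjOn_of_injOn_of_card_le (t := Finset.univ.erase i) f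
      (fun t _ => by simp [hfi t]) hinj (by rw [hcard, Finset.card_univ])
      (show j ∈ ((Finset.univ.erase i : Finset ι) : Set ι) by simp [hij.symm])
    exact ⟨t, ht ▸ hf t⟩
  have hall : ∀ y, ∃ t : F, y + t • x ∈ V j := by
    intro y
    by_cases hy : y ∈ V i
    · obtain ⟨z, hz⟩ : ∃ z, z ∉ V i := by
        by_contra! h
        exact hV i (Submodule.eq_top_iff'.mpr h)
      obtain ⟨t, ht⟩ := hline z hz
      obtain ⟨u, hu⟩ := hline (y + z) fun h => hz (((V i).add_mem_iff_right hy).mp h)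
      refine ⟨u - t, ?_⟩
      convert (V j).sub_mem hu ht using 1
      module
    · exact hline y hy
  refine finrank_eq_one ((V j).mkQ x) (by simpa using hx' j hij.symm) fun w => ?_
  obtain ⟨y, rfl⟩ := (V j).mkQ_surjective w
  obtain ⟨t, ht⟩ := hall y
  refine ⟨-t, ?_⟩
  rw [← map_smul, eq_comm, ← sub_eq_zero, ← map_sub, neg_smul, sub_neg_eq_add]
  exact (Submodule.Quotient.mk_eq_zero _).mpr ht

/-- If a Lie algebra over a finite field `F` is covered by `|F| + 1` proper Lie subalgebras,
then each of them has codimension `1`. -/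
theorem stmt5 (F L : Type*) [Field F] [Fintype F] [LieRing L] [LieAlgebra F L]
    (𝔥 : Fin (Fintype.card F + 1) → LieSubalgebra F L) (hprop : ∀ i, 𝔥 i ≠ ⊤)
    (hcover : ∀ x : L, ∃ i, x ∈ 𝔥 i) :
    ∀ i, Module.finrank F (L ⧸ (𝔥 i).toSubmodule) = 1 := by
  refine Submodule.finrank_quotient_eq_one_of_cover (by simp) (fun i => (𝔥 i).toSubmodule)
    (fun i h => hprop i ?_) hcover
  rwa [← LieSubalgebra.toSubmodule_inj, LieSubalgebra.top_toSubmodule]
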